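/- Let n, m ≥ 1, let K ⊆ ℝ^n be convex and compact, let ℓ : ℝ^n × ℝ^m → ℝ and ω : ℝ^n → ℝ^m be twice continuously differentiable. For a compactly supported Borel probability measure ν on ℝ^n define H²(ν) = ∫ ℓ(z, ∫ ω dν) dν(z). Then there exists C ≥ 0, depending only on K, ℓ and ω, such that for all Borel probability measures ν₀, ν₁ supported in K, every coupling ρ of ν₀ and ν₁, and every s ∈ [0,1]: H²(ν_s) ≤ (1−s) H²(ν₀) + s H²(ν₁) + C s(1−s) ∫ ‖z₀ − z₁‖² dρ(z₀, z₁), where ν_s is the pushforward of ρ under (z₀, z₁) ↦ (1−s)z₀ + s z₁. In particular, taking ρ an optimal coupling for the 2-Wasserstein distance, H² is semiconvex along geodesics. -/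

import Mathlib

open MeasureTheory

/-- The functional `H²(ν) = ∫ ℓ(z, ∫ ω dν) dν(z)`. -/
noncomputable def Htwo (n m : ℕ)
    (ℓ : EuclideanSpace ℝ (Fin n) × EuclideanSpace ℝ (Fin m) → ℝ)
    (ω : EuclideanSpace ℝ (Fin n) → EuclideanSpace ℝ (Fin m))
    (ν : Measure (EuclideanSpace ℝ (Fin n))) : ℝ :=
  ∫ z, ℓ (z, ∫ w, ω w ∂ν) ∂ν

/-- A `C¹` map is Lipschitz on compact convex sets. -/
lemma aux_lip {E F : Type*} [NormedAddCommGroup E] [NormedSpace ℝ E]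
    [NormedAddCommGroup F] [NormedSpace ℝ F] {f : E → F} (hf : ContDiff ℝ 1 f)
    {B : Set E} (hc : Convex ℝ B) (hB : IsCompact B) :
    ∃ L : ℝ, 0 ≤ L ∧ ∀ x ∈ B, ∀ y ∈ B, ‖f x - f y‖ ≤ L * ‖x - y‖ := by
  obtain ⟨L, hL⟩ := hB.exists_bound_of_continuousOn
    (hf.continuous_fderiv (by norm_num)).continuousOn
  refine ⟨max L 0, le_max_right _ _, fun x hx y hy => ?_⟩
  exact hc.norm_image_sub_le_of_norm_fderiv_le (𝕜 := ℝ)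
    (fun z _ => (hf.differentiable (by norm_num)) z)
    (fun z hz => (hL z hz).trans (le_max_left _ _)) hy hx

/-- Two-sided semiconvexity of `C²` maps on compact convex sets. -/
lemma aux_semi {E F : Type*} [NormedAddCommGroup E] [NormedSpace ℝ E]
    [NormedAddCommGroup F] [NormedSpace ℝ F] {f : E → F} (hf : ContDiff ℝ 2 f)
    {B : Set E} (hc : Convex ℝ B) (hB : IsCompact B) :
    ∃ M : ℝ, 0 ≤ M ∧ ∀ x ∈ B, ∀ y ∈ B, ∀ s ∈ Set.Icc (0 : ℝ) 1,
      ‖f ((1 - s) • x + s • y) - ((1 - s) • f x + s • f y)‖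
        ≤ M * (s * (1 - s)) * ‖x - y‖ ^ 2 := by
  have hf1 : ContDiff ℝ 1 (fderiv ℝ f) := hf.fderiv_right (by norm_num)
  obtain ⟨L, hL0, hL⟩ := aux_lip hf1 hc hB
  have hd : Differentiable ℝ f := hf.differentiable (by norm_num)
  have key : ∀ x ∈ B, ∀ y ∈ B, ‖f y - f x - fderiv ℝ f x (y - x)‖ ≤ L * ‖y - x‖ ^ 2 := by
    intro x hx y hy
    have hseg : segment ℝ x y ⊆ B := hc.segment_subset hx hy
    have := (convex_segment x y).norm_image_sub_le_of_norm_hasFDerivWithin_le'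
      (𝕜 := ℝ) (f := f) (f' := fderiv ℝ f) (φ := fderiv ℝ f x) (C := L * ‖y - x‖)
      (fun z _ => (hd z).hasFDerivAt.hasFDerivWithinAt)
      (fun z hz => by
        refine (hL z (hseg hz) x hx).trans ?_
        gcongr
        obtain ⟨t, ⟨ht0, ht1⟩, rfl⟩ := (segment_eq_image' ℝ x y ▸ hz)
        simp only [add_sub_cancel_left, norm_smul, Real.norm_eq_abs, abs_of_nonneg ht0]
        nlinarith [norm_nonneg (y - x)])
      (left_mem_segment ℝ x y) (right_mem_segment ℝ x y)
    calc _ ≤ _ := this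
      _ = _ := by ring
  refine ⟨L, hL0, fun x hx y hy s hs => ?_⟩
  obtain ⟨h0, h1⟩ := hs
  have h1' : 0 ≤ 1 - s := by linarith
  set z := (1 - s) • x + s • y with hz
  have hzB : z ∈ B := hc hx hy h1' h0 (by ring)
  have kx := key z hzB x hx
  have ky := key z hzB y hy
  have ex : x - z = s • (x - y) := by rw [hz]; module
  have ey : y - z = (-(1 - s)) • (x - y) := by rw [hz]; module
  rw [ex] at kx
  rw [ey] at ky
  rw [map_smul, norm_smul, Real.norm_eq_abs, mul_pow, sq_abs] at kx ky
  have e : f z - ((1 - s) • f x + s • f y) =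
      -((1 - s) • (f x - f z - s • fderiv ℝ f z (x - y))
        + s • (f y - f z - (-(1 - s)) • fderiv ℝ f z (x - y))) := by module
  rw [e, norm_neg]
  refine (norm_add_le _ _).trans ?_
  rw [norm_smul, norm_smul, Real.norm_eq_abs, Real.norm_eq_abs, abs_of_nonneg h0,
    abs_of_nonneg h1']
  calc _ ≤ (1 - s) * (L * (s ^ 2 * ‖x - y‖ ^ 2)) + s * (L * ((-(1 - s)) ^ 2 * ‖x - y‖ ^ 2)) := by
        gcongr
    _ = _ := by ring

lemma aux_jensen {α : Type*} [MeasurableSpace α] {ρ : Measure α} [IsProbabilityMeasure ρ]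
    {g : α → ℝ} (hg : Integrable g ρ) (hg2 : Integrable (fun x => g x ^ 2) ρ) :
    (∫ x, g x ∂ρ) ^ 2 ≤ ∫ x, g x ^ 2 ∂ρ := by
  set c := ∫ x, g x ∂ρ with hc
  have h : ∫ x, (2 * c * g x - c ^ 2) ∂ρ ≤ ∫ x, g x ^ 2 ∂ρ :=
    integral_mono ((hg.const_mul _).sub (integrable_const _)) hg2
      (fun x => by dsimp only; nlinarith [sq_nonneg (g x - c)])
  rw [integral_sub (hg.const_mul _) (integrable_const _), integral_const_mul, ← hc] at h
  simp at h
  nlinarith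

/-- For `ℓ` and `ω` of class `C²` and `K` convex compact, there is
`C ≥ 0` depending only on `K, ℓ, ω` such that for all probability measures `ν₀, ν₁`
supported in `K`, every coupling `ρ` and every `s ∈ [0,1]`,
`H²(ν_s) ≤ (1−s) H²(ν₀) + s H²(ν₁) + C s(1−s) ∫ ‖z₀ − z₁‖² dρ`, where `ν_s` is the
pushforward of `ρ` under `(z₀, z₁) ↦ (1−s)z₀ + s z₁`. In particular (taking `ρ` an
optimal coupling for `W₂`), `H²` is semiconvex along geodesics. -/
theorem stmt_13 (n m : ℕ) (hn : 1 ≤ n) (hm : 1 ≤ m)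
    (K : Set (EuclideanSpace ℝ (Fin n))) (hKconv : Convex ℝ K) (hKcomp : IsCompact K)
    (ℓ : EuclideanSpace ℝ (Fin n) × EuclideanSpace ℝ (Fin m) → ℝ) (hℓ : ContDiff ℝ 2 ℓ)
    (ω : EuclideanSpace ℝ (Fin n) → EuclideanSpace ℝ (Fin m)) (hω : ContDiff ℝ 2 ω) :
    ∃ C : ℝ, 0 ≤ C ∧
      ∀ (ν₀ ν₁ : Measure (EuclideanSpace ℝ (Fin n))),
        IsProbabilityMeasure ν₀ → IsProbabilityMeasure ν₁ →
        ν₀ Kᶜ = 0 → ν₁ Kᶜ = 0 →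
      ∀ (ρ : Measure (EuclideanSpace ℝ (Fin n) × EuclideanSpace ℝ (Fin n))),
        IsProbabilityMeasure ρ → ρ.map Prod.fst = ν₀ → ρ.map Prod.snd = ν₁ →
      ∀ s ∈ Set.Icc (0 : ℝ) 1,
        Htwo n m ℓ ω (ρ.map (fun p => (1 - s) • p.1 + s • p.2)) ≤
          (1 - s) * Htwo n m ℓ ω ν₀ + s * Htwo n m ℓ ω ν₁ +
            C * s * (1 - s) * ∫ p, ‖p.1 - p.2‖ ^ 2 ∂ρ := by
  obtain ⟨R, hR⟩ := hKcomp.exists_bound_of_continuousOn hω.continuous.continuousOn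
  have hBconv : Convex ℝ (K ×ˢ Metric.closedBall (0 : EuclideanSpace ℝ (Fin m)) R) :=
    hKconv.prod (convex_closedBall _ _)
  have hBcomp : IsCompact (K ×ˢ Metric.closedBall (0 : EuclideanSpace ℝ (Fin m)) R) :=
    hKcomp.prod (isCompact_closedBall _ _)
  obtain ⟨Lω, hLω0, hLω⟩ := aux_lip (hω.of_le (by norm_num)) hKconv hKcomp
  obtain ⟨Mω, hMω0, hMω⟩ := aux_semi hω hKconv hKcomp
  obtain ⟨Lℓ, hLℓ0, hLℓ⟩ := aux_lip (hℓ.of_le (by norm_num)) hBconv hBcomp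
  obtain ⟨Mℓ, hMℓ0, hMℓ⟩ := aux_semi hℓ hBconv hBcomp
  refine ⟨Lℓ * Mω + Mℓ * (1 + Lω ^ 2), by positivity, ?_⟩
  intro ν₀ ν₁ _ _ h0K h1K ρ _ hρ0 hρ1 s hs
  have hs' := hs
  obtain ⟨hs0, hs1⟩ := hs'
  have hs1' : 0 ≤ 1 - s := by linarith
  subst hρ0 hρ1
  have hm : MeasurableSet Kᶜ := hKcomp.isClosed.measurableSet.compl
  have ae0 : ∀ᵐ p ∂ρ, p.1 ∈ K := by
    rw [Measure.map_apply measurable_fst hm] at h0K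
    exact h0K
  have ae1 : ∀ᵐ p ∂ρ, p.2 ∈ K := by
    rw [Measure.map_apply measurable_snd hm] at h1K
    exact h1K
  have aes : ∀ᵐ p ∂ρ, (1 - s) • p.1 + s • p.2 ∈ K := by
    filter_upwards [ae0, ae1] with p h0 h1 using hKconv h0 h1 hs1' hs0 (by ring)
  have aeKK : ∀ᵐ p ∂ρ, p ∈ K ×ˢ K := by
    filter_upwards [ae0, ae1] with p h0 h1 using ⟨h0, h1⟩
  -- continuous functions are integrable
  have hcint : ∀ {G : Type} [NormedAddCommGroup G] [SecondCountableTopology G]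
      (g : EuclideanSpace ℝ (Fin n) × EuclideanSpace ℝ (Fin n) → G), Continuous g →
      Integrable g ρ := by
    intro G _ _ g hg
    obtain ⟨A, hA⟩ := (hKcomp.prod hKcomp).exists_bound_of_continuousOn hg.continuousOn
    exact Integrable.of_bound hg.aestronglyMeasurable A (aeKK.mono hA)
  have hcs : Continuous (fun p : EuclideanSpace ℝ (Fin n) × EuclideanSpace ℝ (Fin n) =>
      (1 - s) • p.1 + s • p.2) := by fun_prop
  have hωc := hω.continuous
  have hℓc := hℓ.continuous
  unfold Htwo
  have mω : ∀ φ : EuclideanSpace ℝ (Fin n) × EuclideanSpace ℝ (Fin n) →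
      EuclideanSpace ℝ (Fin n), Continuous φ →
      ∫ w, ω w ∂(ρ.map φ) = ∫ p, ω (φ p) ∂ρ := fun φ hφ =>
    integral_map hφ.measurable.aemeasurable hωc.aestronglyMeasurable
  have mℓ : ∀ φ : EuclideanSpace ℝ (Fin n) × EuclideanSpace ℝ (Fin n) →
      EuclideanSpace ℝ (Fin n), Continuous φ → ∀ a,
      ∫ z, ℓ (z, a) ∂(ρ.map φ) = ∫ p, ℓ (φ p, a) ∂ρ := fun φ hφ a =>
    integral_map hφ.measurable.aemeasurable
      (Continuous.aestronglyMeasurable (by fun_prop))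
  rw [mω _ hcs, mω _ continuous_fst, mω _ continuous_snd, mℓ _ hcs, mℓ _ continuous_fst,
    mℓ _ continuous_snd]
  have hball : ∀ φ : EuclideanSpace ℝ (Fin n) × EuclideanSpace ℝ (Fin n) →
      EuclideanSpace ℝ (Fin n), (∀ᵐ p ∂ρ, φ p ∈ K) →
      ∫ p, ω (φ p) ∂ρ ∈ Metric.closedBall (0 : EuclideanSpace ℝ (Fin m)) R := by
    intro φ hφ
    have := norm_integral_le_of_norm_le_const (μ := ρ) (hφ.mono fun p hp => hR _ hp)
    simpa using this
  have Bs := hball _ aes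
  have B0 := hball _ ae0
  have B1 := hball _ ae1
  set D := ∫ p, ‖p.1 - p.2‖ ^ 2 ∂ρ with hD
  have iD : Integrable (fun p : EuclideanSpace ℝ (Fin n) × EuclideanSpace ℝ (Fin n) =>
    ‖p.1 - p.2‖ ^ 2) ρ := hcint _ (by fun_prop)
  have iD1 : Integrable (fun p : EuclideanSpace ℝ (Fin n) × EuclideanSpace ℝ (Fin n) =>
    ‖p.1 - p.2‖) ρ := hcint _ (by fun_prop)
  have i0 : Integrable (fun p => ω p.1) ρ := hcint _ (by fun_prop)
  have i1 : Integrable (fun p => ω p.2) ρ := hcint _ (by fun_prop)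
  have is : Integrable (fun p => ω ((1 - s) • p.1 + s • p.2)) ρ := hcint _ (by fun_prop)
  -- barycenter estimates
  have d1 : ‖∫ p, ω ((1 - s) • p.1 + s • p.2) ∂ρ -
      ((1 - s) • ∫ p, ω p.1 ∂ρ + s • ∫ p, ω p.2 ∂ρ)‖ ≤ Mω * (s * (1 - s)) * D := by
    have k0 : Integrable (fun p => (1 - s) • ω p.1) ρ := hcint _ (by fun_prop)
    have k1 : Integrable (fun p => s • ω p.2) ρ := hcint _ (by fun_prop)
    have k2 : Integrable (fun p => (1 - s) • ω p.1 + s • ω p.2) ρ := hcint _ (by fun_prop)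
    rw [← integral_smul, ← integral_smul, ← integral_add k0 k1,
      ← integral_sub is k2, hD, ← integral_const_mul]
    refine norm_integral_le_of_norm_le (iD.const_mul _) ?_
    filter_upwards [ae0, ae1] with p h0 h1 using hMω _ h0 _ h1 s hs
  have d2 : ‖∫ p, ω p.1 ∂ρ - ∫ p, ω p.2 ∂ρ‖ ^ 2 ≤ Lω ^ 2 * D := by
    have h : ‖∫ p, ω p.1 ∂ρ - ∫ p, ω p.2 ∂ρ‖ ≤ Lω * ∫ p, ‖p.1 - p.2‖ ∂ρ := by
      rw [← integral_sub i0 i1, ← integral_const_mul]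
      refine norm_integral_le_of_norm_le (iD1.const_mul _) ?_
      filter_upwards [ae0, ae1] with p h0 h1 using hLω _ h0 _ h1
    calc _ ≤ (Lω * ∫ p, ‖p.1 - p.2‖ ∂ρ) ^ 2 := by gcongr
      _ = Lω ^ 2 * (∫ p, ‖p.1 - p.2‖ ∂ρ) ^ 2 := by ring
      _ ≤ _ := by
        gcongr
        exact aux_jensen iD1 iD
  generalize (∫ p, ω ((1 - s) • p.1 + s • p.2) ∂ρ) = as at *
  generalize (∫ p, ω p.1 ∂ρ) = a0 at *
  generalize (∫ p, ω p.2 ∂ρ) = a1 at *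
  have hbs : (1 - s) • a0 + s • a1 ∈ Metric.closedBall (0 : EuclideanSpace ℝ (Fin m)) R :=
    convex_closedBall _ _ B0 B1 hs1' hs0 (by ring)
  have j0 : Integrable (fun p => ℓ (p.1, a0)) ρ := hcint _ (by fun_prop)
  have j1 : Integrable (fun p => ℓ (p.2, a1)) ρ := hcint _ (by fun_prop)
  have js : Integrable (fun p => ℓ ((1 - s) • p.1 + s • p.2, as)) ρ := hcint _ (by fun_prop)
  have pt : ∀ᵐ p ∂ρ, ℓ ((1 - s) • p.1 + s • p.2, as) ≤
      (1 - s) * ℓ (p.1, a0) + s * ℓ (p.2, a1) +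
        (Mℓ * (s * (1 - s)) * ‖p.1 - p.2‖ ^ 2 +
          (Lℓ * (Mω * (s * (1 - s)) * D) + Mℓ * (s * (1 - s)) * (Lω ^ 2 * D))) := by
    filter_upwards [ae0, ae1, aes] with p h0 h1 hps
    have e1 := hLℓ ((1 - s) • p.1 + s • p.2, as) ⟨hps, Bs⟩
      ((1 - s) • p.1 + s • p.2, (1 - s) • a0 + s • a1) ⟨hps, hbs⟩
    have e2 := hMℓ (p.1, a0) ⟨h0, B0⟩ (p.2, a1) ⟨h1, B1⟩ s hs
    simp only [Prod.mk_sub_mk, sub_self, Prod.smul_mk, Prod.mk_add_mk, smul_eq_mul] at e1 e2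
    have n1 : ‖((0 : EuclideanSpace ℝ (Fin n)), as - ((1 - s) • a0 + s • a1))‖ ≤
        Mω * (s * (1 - s)) * D := by
      rw [Prod.norm_mk, norm_zero, max_eq_right (norm_nonneg _)]
      exact d1
    have n2 : ‖(p.1 - p.2, a0 - a1)‖ ^ 2 ≤ ‖p.1 - p.2‖ ^ 2 + Lω ^ 2 * D := by
      rw [Prod.norm_mk]
      rcases max_cases ‖p.1 - p.2‖ ‖a0 - a1‖ with h | h <;> rw [h.1]
      · linarith [sq_nonneg ‖a0 - a1‖]
      · linarith [sq_nonneg ‖p.1 - p.2‖]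
    have e1' := (le_abs_self _).trans (e1.trans (mul_le_mul_of_nonneg_left n1 hLℓ0))
    have e2' := (le_abs_self _).trans (e2.trans (mul_le_mul_of_nonneg_left n2
      (mul_nonneg hMℓ0 (mul_nonneg hs0 hs1'))))
    linarith
  have jr := (j0.const_mul (1 - s)).add (j1.const_mul s)
  have jt := (iD.const_mul (Mℓ * (s * (1 - s)))).add (integrable_const (μ := ρ)
    (Lℓ * (Mω * (s * (1 - s)) * D) + Mℓ * (s * (1 - s)) * (Lω ^ 2 * D)))
  have fin := integral_mono_ae js (jr.add jt) pt
  refine fin.trans (le_of_eq ?_)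
  rw [integral_add' jr jt, integral_add' (j0.const_mul (1 - s)) (j1.const_mul s),
    integral_add' (iD.const_mul (Mℓ * (s * (1 - s)))) (integrable_const _),
    integral_const_mul, integral_const_mul, integral_const_mul, ← hD]
  simp
  ring
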